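/- Partition function lower bound for an area-tilted walk: there exist c* > 0 and N₀ such that for all N ≥ N₀, all λ ∈ (0, N), all A, B > 0 with max(A,B) ≤ H_λ² and any interval I with |I| ≥ 2·max(A^{1/2}, B^{1/2})·H_λ², the expectation E^{AH_λ, BH_λ}_{I;0}[exp(-(λ/N)·𝒜(X))] over random walk bridges from AH_λ to BH_λ staying above 0 is at least (c*)^{-1}·exp(-c*(A^{3/2} + B^{3/2} + |I|/H_λ²)), where H_λ = λ^{-1/3} N^{1/3} and 𝒜(X) = Σ_{j∈I} X(j). -/

import Mathlib

open MeasureTheory Real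
open scoped ENNReal

noncomputable section

/-- The full trajectory over `⟦0, n+1⟧` of a bridge with boundary values `u, v`
and interior values `q`. -/
def pathOf (u v : ℝ) (n : ℕ) (q : Fin n → ℝ) : ℕ → ℝ :=
  fun t => if h : 1 ≤ t ∧ t ≤ n then q ⟨t - 1, by omega⟩ else if t = 0 then u else v

/-- Unnormalized density of a random walk bridge on `⟦0, n+1⟧` from `u` to `v`,
with increment Hamiltonian `H`: the product of `exp(-H(increment))` over all steps. -/
def bridgeDensity (H : ℝ → ℝ) (u v : ℝ) (n : ℕ) (q : Fin n → ℝ) : ℝ :=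
  ∏ j ∈ Finset.range (n + 1),
    Real.exp (-(H (pathOf u v n q (j + 1) - pathOf u v n q j)))

/-- The (unnormalized) law of the interior points of a random walk bridge. -/
def bridgeMeasure (H : ℝ → ℝ) (u v : ℝ) (n : ℕ) : Measure (Fin n → ℝ) :=
  volume.withDensity fun q => ENNReal.ofReal (bridgeDensity H u v n q)

open scoped Classical in
/-- The (unnormalized) law of a random walk bridge on `⟦0, n+1⟧` from `u` to `v`
constrained to stay above the floor in the interior, with area tilt
`exp(-c · Σ_j (X(j) - floor(j)))`. -/
def tiltedMeasure (H : ℝ → ℝ) (u v : ℝ) (n : ℕ) (c : ℝ) (floor : ℕ → ℝ) :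
    Measure (Fin n → ℝ) :=
  volume.withDensity fun q =>
    ENNReal.ofReal (bridgeDensity H u v n q
      * Real.exp (-(c * ∑ j ∈ Finset.range (n + 1), (pathOf u v n q j - floor j)))
      * if ∀ t, 1 ≤ t → t ≤ n → floor t ≤ pathOf u v n q t then 1 else 0)

/-- Probability of an event under the normalization of a finite measure. -/
def probOf {α : Type*} [MeasurableSpace α] (μ : Measure α) (E : Set α) : ℝ≥0∞ :=
  μ E / μ Set.univ

/-- The normalized (probability) version of a measure. -/
def normalizeMeasure {α : Type*} [MeasurableSpace α] (μ : Measure α) : Measure α :=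
  (μ Set.univ)⁻¹ • μ

/-- Fluctuation scale `H_λ = λ^{-1/3} N^{1/3}`. -/
def Hlam (lam N : ℝ) : ℝ := lam ^ (-(1 : ℝ) / 3) * N ^ ((1 : ℝ) / 3)

/-- Assumptions on the random walk Hamiltonian: convexity (log-concavity of the
increment density), zero mean, positive finite variance, and finite exponential
moments near zero. -/
structure RWAssumptions (H : ℝ → ℝ) : Prop where
  convex : ConvexOn ℝ Set.univ H
  integrable_exp : Integrable fun x : ℝ => Real.exp (-(H x))
  norm_pos : 0 < ∫ x : ℝ, Real.exp (-(H x))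
  mean_zero : (∫ x : ℝ, x * Real.exp (-(H x))) = 0
  integrable_sq : Integrable fun x : ℝ => x ^ 2 * Real.exp (-(H x))
  var_pos : 0 < ∫ x : ℝ, x ^ 2 * Real.exp (-(H x))
  mgf : ∃ t₀ > 0, ∀ t : ℝ, |t| ≤ t₀ →
    Integrable fun x : ℝ => Real.exp (t * x) * Real.exp (-(H x))

end

/-- One step of a killed random walk on `[0, ∞)` with area tilt `c`, acting on functions. -/
noncomputable def stepOp (K : ℝ → ℝ≥0∞) (c : ℝ) (φ : ℝ → ℝ≥0∞) (a : ℝ) : ℝ≥0∞ :=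
  ENNReal.ofReal (Real.exp (-(c * a))) * ∫⁻ x in Set.Ici 0, K (x - a) * φ x

/-- Partition function of the bridge from `a` to `b` with `n` interior points, step kernel `K` and
area tilt `c`, defined by recursion on the first step. -/
noncomputable def walkPartition (K : ℝ → ℝ≥0∞) (c b : ℝ) : ℕ → ℝ → ℝ≥0∞
  | 0 => fun a => ENNReal.ofReal (Real.exp (-(c * a))) * K (b - a)
  | n + 1 => stepOp K c (walkPartition K c b n)

section PathRecursion

open scoped Classical in
/-- Density of the area-tilted bridge constrained to stay nonnegative. -/
noncomputable def tiltedDensity (H : ℝ → ℝ) (u v : ℝ) (n : ℕ) (c : ℝ) (q : Fin n → ℝ) : ℝ≥0∞ :=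
  ENNReal.ofReal (bridgeDensity H u v n q
    * Real.exp (-(c * ∑ j ∈ Finset.range (n + 1), (pathOf u v n q j - 0)))
    * if ∀ t, 1 ≤ t → t ≤ n → 0 ≤ pathOf u v n q t then 1 else 0)

lemma tiltedMeasure_univ (H : ℝ → ℝ) (u v : ℝ) (n : ℕ) (c : ℝ) :
    tiltedMeasure H u v n c (fun _ => 0) Set.univ = ∫⁻ q, tiltedDensity H u v n c q := by
  rw [tiltedMeasure, withDensity_apply _ MeasurableSet.univ, Measure.restrict_univ]
  rfl

lemma pathOf_zero (u v : ℝ) (n : ℕ) (q : Fin n → ℝ) : pathOf u v n q 0 = u := by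
  simp [pathOf]

lemma pathOf_cons_succ (u v x : ℝ) (n : ℕ) (q : Fin n → ℝ) (t : ℕ) :
    pathOf u v (n + 1) (Fin.cons x q) (t + 1) = pathOf x v n q t := by
  rcases Nat.eq_zero_or_pos t with rfl | ht
  · simp only [pathOf, zero_add, le_refl, Nat.le_add_left, and_self, dite_true]
    rfl
  · obtain ⟨s, rfl⟩ : ∃ s, t = s + 1 := ⟨t - 1, by omega⟩
    by_cases h : s + 1 ≤ n
    · have h' : s + 1 + 1 ≤ n + 1 := by omega
      have : (⟨s + 1, by omega⟩ : Fin (n + 1)) = Fin.succ ⟨s, by omega⟩ := rfl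
      simp only [pathOf, h, h', Nat.le_add_left, and_self, dite_true, Nat.add_sub_cancel, this,
        Fin.cons_succ]
    · have h' : ¬ s + 1 + 1 ≤ n + 1 := by omega
      simp only [pathOf, h, h', and_false, dite_false, Nat.add_eq_zero_iff, one_ne_zero, if_false]

lemma measurable_pathOf (u v : ℝ) (n t : ℕ) : Measurable fun q => pathOf u v n q t := by
  unfold pathOf
  by_cases h : 1 ≤ t ∧ t ≤ n
  · simp only [h, and_self, dite_true]
    exact measurable_pi_apply _
  · simp only [h, dite_false]
    exact measurable_const

lemma measurable_bridgeDensity {H : ℝ → ℝ} (hH : Measurable H) (u v : ℝ) (n : ℕ) :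
    Measurable fun q => bridgeDensity H u v n q := by
  unfold bridgeDensity
  refine Finset.measurable_prod _ fun j _ => ?_
  exact Real.measurable_exp.comp
    (hH.comp ((measurable_pathOf u v n _).sub (measurable_pathOf u v n _))).neg

lemma measurable_tiltedDensity {H : ℝ → ℝ} (hH : Measurable H) (u v : ℝ) (n : ℕ) (c : ℝ) :
    Measurable (tiltedDensity H u v n c) := by
  refine ENNReal.measurable_ofReal.comp (Measurable.mul (Measurable.mul ?_ ?_) ?_)
  · exact measurable_bridgeDensity hH u v n
  · refine Real.measurable_exp.comp (Measurable.neg (Measurable.const_mul ?_ _))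
    exact Finset.measurable_sum _ fun j _ => (measurable_pathOf u v n j).sub_const 0
  · refine Measurable.ite ?_ measurable_const measurable_const
    have : {q : Fin n → ℝ | ∀ t, 1 ≤ t → t ≤ n → 0 ≤ pathOf u v n q t}
        = ⋂ t : ℕ, ⋂ _ : 1 ≤ t, ⋂ _ : t ≤ n, {q | 0 ≤ pathOf u v n q t} := by
      ext q; simp
    rw [this]
    exact MeasurableSet.iInter fun t => MeasurableSet.iInter fun _ => MeasurableSet.iInter fun _ =>
      measurableSet_le measurable_const (measurable_pathOf u v n t)

lemma tiltedDensity_cons (H : ℝ → ℝ) (u v x : ℝ) (n : ℕ) (c : ℝ) (q : Fin n → ℝ) :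
    tiltedDensity H u v (n + 1) c (Fin.cons x q)
    = (ENNReal.ofReal (Real.exp (-(c * u))) *
        (Set.Ici (0 : ℝ)).indicator (fun x => ENNReal.ofReal (Real.exp (-(H (x - u))))) x) *
      tiltedDensity H x v n c q := by
  have h1 : bridgeDensity H u v (n + 1) (Fin.cons x q)
      = bridgeDensity H x v n q * Real.exp (-(H (x - u))) := by
    unfold bridgeDensity
    rw [Finset.prod_range_succ']
    simp only [pathOf_cons_succ, pathOf_zero]
  have h2 : ∑ j ∈ Finset.range (n + 1 + 1), (pathOf u v (n + 1) (Fin.cons x q) j - 0)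
      = ∑ j ∈ Finset.range (n + 1), (pathOf x v n q j - 0) + u := by
    rw [Finset.sum_range_succ']
    simp only [pathOf_cons_succ, pathOf_zero, sub_zero]
  have h3 : (∀ t, 1 ≤ t → t ≤ n + 1 → 0 ≤ pathOf u v (n + 1) (Fin.cons x q) t)
      ↔ 0 ≤ x ∧ ∀ t, 1 ≤ t → t ≤ n → 0 ≤ pathOf x v n q t := by
    constructor
    · intro h
      refine ⟨?_, fun t _ h2 => ?_⟩
      · simpa only [pathOf_cons_succ, pathOf_zero] using h (0 + 1) le_rfl (by omega)
      · simpa only [pathOf_cons_succ] using h (t + 1) (by omega) (by omega)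
    · rintro ⟨h0, h⟩ t ht htn
      obtain ⟨s, rfl⟩ : ∃ s, t = s + 1 := ⟨t - 1, by omega⟩
      rw [pathOf_cons_succ]
      rcases Nat.eq_zero_or_pos s with rfl | hs
      · rwa [pathOf_zero]
      · exact h s hs (by omega)
  unfold tiltedDensity
  simp only [h1, h2, h3]
  by_cases hx : 0 ≤ x
  · rw [Set.indicator_of_mem (show x ∈ Set.Ici (0 : ℝ) from hx),
      ← ENNReal.ofReal_mul (by positivity), ← ENNReal.ofReal_mul (by positivity)]
    congr 1
    rw [mul_add, neg_add, Real.exp_add]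
    simp only [hx, true_and]
    ring_nf
  · rw [Set.indicator_of_notMem (show x ∉ Set.Ici (0 : ℝ) from hx)]
    simp [hx]

lemma tiltedMeasure_univ_eq_walkPartition {H : ℝ → ℝ} (hH : Measurable H) (u v : ℝ) (n : ℕ)
    (c : ℝ) :
    tiltedMeasure H u v n c (fun _ => 0) Set.univ
      = walkPartition (fun x => ENNReal.ofReal (Real.exp (-(H x)))) c v n u := by
  induction n generalizing u with
  | zero =>
    rw [tiltedMeasure_univ, volume_pi, Measure.pi_of_empty _ 0, lintegral_dirac]
    simp only [tiltedDensity, walkPartition, bridgeDensity, zero_add, Finset.range_one,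
      Finset.prod_singleton, Finset.sum_singleton, pathOf_zero, sub_zero]
    rw [if_pos (by intro t h1 h2; omega), mul_one, mul_comm, ENNReal.ofReal_mul (by positivity)]
    simp [pathOf]
  | succ n ih =>
    rw [tiltedMeasure_univ,
      ← ((volume_preserving_piFinSuccAbove (fun _ : Fin (n + 1) => ℝ) 0).symm).lintegral_comp_emb
      (MeasurableEquiv.measurableEmbedding _)]
    have hm := ((measurable_tiltedDensity hH u v (n + 1) c).comp
      (MeasurableEquiv.piFinSuccAbove (fun _ : Fin (n + 1) => ℝ) 0).symm.measurable)
    rw [Measure.volume_eq_prod]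
    refine (lintegral_prod _ hm.aemeasurable).trans ?_
    have key : ∀ x (q : Fin n → ℝ),
        (MeasurableEquiv.piFinSuccAbove (fun _ : Fin (n + 1) => ℝ) 0).symm (x, q)
          = (Fin.cons x q : Fin (n + 1) → ℝ) := by
      intro x q
      simp [MeasurableEquiv.piFinSuccAbove, Fin.insertNthEquiv]
    simp only [Function.comp_apply, key, tiltedDensity_cons]
    rw [walkPartition, stepOp, ← lintegral_const_mul' _ _ ENNReal.ofReal_ne_top,
      ← lintegral_indicator measurableSet_Ici]
    refine lintegral_congr fun x => ?_
    refine (lintegral_const_mul _ (measurable_tiltedDensity hH x v n c)).trans ?_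
    rw [← tiltedMeasure_univ, ih x]
    by_cases hx : x ∈ Set.Ici (0 : ℝ)
    · simp only [Set.indicator_of_mem hx, mul_assoc]
    · simp [Set.indicator_of_notMem hx]

end PathRecursion

section FourFunctions

lemma ENNReal.add_le_add_of_mul_le_mul {a b c d : ℝ≥0∞} (ha : a ≤ c) (hb : b ≤ c)
    (h : a * b ≤ c * d) : a + b ≤ c + d := by
  rcases eq_or_ne c ∞ with rfl | hc
  · simp
  rcases eq_or_ne d ∞ with rfl | hd
  · simp
  have ha' := ne_top_of_le_ne_top hc ha
  have hb' := ne_top_of_le_ne_top hc hb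
  lift a to NNReal using ha'
  lift b to NNReal using hb'
  lift c to NNReal using hc
  lift d to NNReal using hd
  norm_cast at *
  rw [← NNReal.coe_le_coe] at *
  push_cast at *
  rcases (NNReal.coe_nonneg c).eq_or_lt with hc | hc
  · linarith [NNReal.coe_nonneg d]
  · nlinarith [mul_nonneg (sub_nonneg.2 ha) (sub_nonneg.2 hb)]

/-- The continuous four functions inequality (Ahlswede–Daykin) on `ℝ`. -/
lemma lintegral_mul_lintegral_le_of_inf_sup {f₁ f₂ f₃ f₄ : ℝ → ℝ≥0∞} (h₁ : Measurable f₁)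
    (h₂ : Measurable f₂) (h₃ : Measurable f₃) (h₄ : Measurable f₄)
    (h : ∀ x y, f₁ x * f₂ y ≤ f₃ (x ⊓ y) * f₄ (x ⊔ y)) :
    (∫⁻ x, f₁ x) * ∫⁻ x, f₂ x ≤ (∫⁻ x, f₃ x) * ∫⁻ x, f₄ x := by
  have symm : ∀ {f g : ℝ → ℝ≥0∞}, Measurable f → Measurable g →
      2 * ((∫⁻ x, f x) * ∫⁻ x, g x) = ∫⁻ x, ∫⁻ y, (f x * g y + f y * g x) := by
    intro f g hf hg
    have e1 : ∫⁻ x, ∫⁻ y, f x * g y = (∫⁻ x, f x) * ∫⁻ x, g x :=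
      lintegral_lintegral_mul hf.aemeasurable hg.aemeasurable
    have e2 : ∫⁻ x, ∫⁻ y, f y * g x = (∫⁻ x, f x) * ∫⁻ x, g x := by
      rw [← e1]
      exact lintegral_lintegral_swap
        ((hf.comp measurable_snd).mul (hg.comp measurable_fst)).aemeasurable
    have e3 : ∀ x, ∫⁻ y, (f x * g y + f y * g x) = (∫⁻ y, f x * g y) + ∫⁻ y, f y * g x :=
      fun x => lintegral_add_left (hg.const_mul _) _
    simp_rw [e3]
    rw [lintegral_add_left, e1, e2, two_mul]
    exact Measurable.lintegral_prod_right'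
      (f := fun z : ℝ × ℝ => f z.1 * g z.2) ((hf.comp measurable_fst).mul (hg.comp measurable_snd))
  have main : ∀ x y, x ≤ y → f₁ x * f₂ y + f₁ y * f₂ x ≤ f₃ x * f₄ y + f₃ y * f₄ x := by
    intro x y hxy
    have a1 := h x y
    have a2 := h y x
    have a3 := h x x
    have a4 := h y y
    simp only [inf_eq_left.2 hxy, sup_eq_right.2 hxy, inf_eq_right.2 hxy, sup_eq_left.2 hxy,
      inf_idem, sup_idem] at a1 a2 a3 a4
    refine ENNReal.add_le_add_of_mul_le_mul a1 a2 ?_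
    calc f₁ x * f₂ y * (f₁ y * f₂ x) = (f₁ x * f₂ x) * (f₁ y * f₂ y) := by ring
      _ ≤ (f₃ x * f₄ x) * (f₃ y * f₄ y) := mul_le_mul' a3 a4
      _ = _ := by ring
  have : 2 * ((∫⁻ x, f₁ x) * ∫⁻ x, f₂ x) ≤ 2 * ((∫⁻ x, f₃ x) * ∫⁻ x, f₄ x) := by
    rw [symm h₁ h₂, symm h₃ h₄]
    refine lintegral_mono fun x => lintegral_mono fun y => ?_
    rcases le_total x y with hxy | hxy
    · exact main x y hxy
    · have := main y x hxy
      rwa [add_comm, add_comm (f₃ x * f₄ y)]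
  rwa [ENNReal.mul_le_mul_iff_right (by simp) (by simp)] at this

end FourFunctions

section Monotonicity

lemma measurable_walkPartition {K : ℝ → ℝ≥0∞} (hK : Measurable K) (c : ℝ) (n : ℕ) :
    Measurable fun z : ℝ × ℝ => walkPartition K c z.2 n z.1 := by
  have hexp : Measurable fun z : ℝ × ℝ => ENNReal.ofReal (Real.exp (-(c * z.1))) := by fun_prop
  induction n with
  | zero => exact hexp.mul (hK.comp (measurable_snd.sub measurable_fst))
  | succ n ih =>
    refine hexp.mul (Measurable.lintegral_prod_right'
      (f := fun w : (ℝ × ℝ) × ℝ => K (w.2 - w.1.1) * walkPartition K c w.1.2 n w.2) ?_)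
    exact (hK.comp (measurable_snd.sub measurable_fst.fst)).mul
      (ih.comp (measurable_snd.prodMk measurable_fst.snd))

lemma measurable_walkPartition_left {K : ℝ → ℝ≥0∞} (hK : Measurable K) (c b : ℝ) (n : ℕ) :
    Measurable (walkPartition K c b n) :=
  (measurable_walkPartition hK c n).comp (measurable_id.prodMk measurable_const)

lemma measurable_walkPartition_right {K : ℝ → ℝ≥0∞} (hK : Measurable K) (c a : ℝ) (n : ℕ) :
    Measurable fun b => walkPartition K c b n a :=
  (measurable_walkPartition hK c n).comp (measurable_const.prodMk measurable_id)

/-- Kernels for which the two-point function `(x, a) ↦ K (x - a)` is totally positive of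
order two. -/
def IsTotallyPositive (K : ℝ → ℝ≥0∞) : Prop :=
  ∀ x y a b, K (x - a) * K (y - b) ≤ K (x ⊓ y - a ⊓ b) * K (x ⊔ y - a ⊔ b)

lemma ConvexOn.add_le_add_of_mem_Icc {H : ℝ → ℝ} (hH : ConvexOn ℝ Set.univ H) {s t₁ t₂ w : ℝ}
    (h₁ : s ≤ t₁) (h₂ : s ≤ t₂) (h : t₁ + t₂ = s + w) : H t₁ + H t₂ ≤ H s + H w := by
  rcases (show s ≤ w by linarith).eq_or_lt with rfl | hsw
  · rw [show t₁ = s by linarith, show t₂ = s by linarith]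
  have hne : w - s ≠ 0 := by linarith
  have hpos : 0 < w - s := by linarith
  set r := (t₁ - s) / (w - s) with hr
  have hr0 : 0 ≤ r := div_nonneg (by linarith) hpos.le
  have hr1 : 0 ≤ 1 - r := by
    rw [sub_nonneg, hr, div_le_one hpos]; linarith
  have hrm : r * (w - s) = t₁ - s := div_mul_cancel₀ _ hne
  have e1 := hH.2 (Set.mem_univ s) (Set.mem_univ w) hr1 hr0 (by ring)
  have e2 := hH.2 (Set.mem_univ s) (Set.mem_univ w) hr0 hr1 (by ring)
  simp only [smul_eq_mul] at e1 e2
  rw [show (1 - r) * s + r * w = t₁ by linarith] at e1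
  rw [show r * s + (1 - r) * w = t₂ by linarith] at e2
  linarith

lemma isTotallyPositive_of_convexOn {H : ℝ → ℝ} (hH : ConvexOn ℝ Set.univ H) :
    IsTotallyPositive fun x => ENNReal.ofReal (Real.exp (-(H x))) := by
  have cross : ∀ x y a b : ℝ, x ≤ y → b ≤ a →
      H (x - b) + H (y - a) ≤ H (x - a) + H (y - b) := fun x y a b hxy hab =>
    hH.add_le_add_of_mem_Icc (by linarith) (by linarith) (by ring)
  intro x y a b
  simp only
  rw [← ENNReal.ofReal_mul (by positivity), ← ENNReal.ofReal_mul (by positivity),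
    ← Real.exp_add, ← Real.exp_add]
  refine ENNReal.ofReal_le_ofReal (Real.exp_le_exp.2 ?_)
  rcases le_total x y with hxy | hxy <;> rcases le_total a b with hab | hab <;>
    simp only [hxy, hab, inf_of_le_left, inf_of_le_right, sup_of_le_left, sup_of_le_right]
  · rfl
  · linarith [cross x y a b hxy hab]
  · linarith [cross y x b a hxy hab]
  · linarith

lemma walkPartition_mul_le_inf_sup {K : ℝ → ℝ≥0∞} (hK : Measurable K) (hTP : IsTotallyPositive K)
    {c : ℝ} (hc : 0 ≤ c) {b b' : ℝ} (hb : b ≤ b') (n : ℕ) (a a' : ℝ) :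
    walkPartition K 0 b n a * walkPartition K c b' n a'
      ≤ walkPartition K c b n (a ⊓ a') * walkPartition K 0 b' n (a ⊔ a') := by
  have hexp : ∀ a a' : ℝ, ENNReal.ofReal (Real.exp (-(c * a')))
      ≤ ENNReal.ofReal (Real.exp (-(c * (a ⊓ a')))) := by
    intro a a'
    refine ENNReal.ofReal_le_ofReal (Real.exp_le_exp.2 ?_)
    have := mul_le_mul_of_nonneg_left (inf_le_right : a ⊓ a' ≤ a') hc
    linarith
  induction n generalizing a a' with
  | zero =>
    simp only [walkPartition, zero_mul, neg_zero, Real.exp_zero, ENNReal.ofReal_one, one_mul]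
    have := hTP b b' a a'
    rw [inf_eq_left.2 hb, sup_eq_right.2 hb] at this
    calc K (b - a) * (ENNReal.ofReal (Real.exp (-(c * a'))) * K (b' - a'))
        = ENNReal.ofReal (Real.exp (-(c * a'))) * (K (b - a) * K (b' - a')) := by ring
      _ ≤ ENNReal.ofReal (Real.exp (-(c * (a ⊓ a')))) * (K (b - a ⊓ a') * K (b' - a ⊔ a')) :=
        mul_le_mul' (hexp a a') this
      _ = _ := by ring
  | succ n ih =>
    simp only [walkPartition, stepOp, zero_mul, neg_zero, Real.exp_zero, ENNReal.ofReal_one,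
      one_mul]
    simp only [← lintegral_indicator measurableSet_Ici]
    have hm : ∀ (c a b : ℝ), Measurable
        ((Set.Ici (0 : ℝ)).indicator fun x => K (x - a) * walkPartition K c b n x) :=
      fun c a b => ((hK.comp (measurable_id.sub_const a)).mul
        (measurable_walkPartition_left hK c b n)).indicator measurableSet_Ici
    have := lintegral_mul_lintegral_le_of_inf_sup (hm 0 a b) (hm c a' b') (hm c (a ⊓ a') b)
      (hm 0 (a ⊔ a') b') ?_
    · calc _ = ENNReal.ofReal (Real.exp (-(c * a'))) * (_ * _) := by ring
        _ ≤ ENNReal.ofReal (Real.exp (-(c * (a ⊓ a')))) * (_ * _) := mul_le_mul' (hexp a a') this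
        _ = _ := by ring
    · intro x y
      by_cases hx : x ∈ Set.Ici (0 : ℝ)
      swap
      · simp [Set.indicator_of_notMem hx]
      by_cases hy : y ∈ Set.Ici (0 : ℝ)
      swap
      · simp [Set.indicator_of_notMem hy]
      have hi : x ⊓ y ∈ Set.Ici (0 : ℝ) := Set.mem_Ici.2 (le_inf hx hy)
      have hs : x ⊔ y ∈ Set.Ici (0 : ℝ) := Set.mem_Ici.2 (le_trans hx le_sup_left)
      rw [Set.indicator_of_mem hx, Set.indicator_of_mem hy, Set.indicator_of_mem hi,
        Set.indicator_of_mem hs]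
      calc _ = (K (x - a) * K (y - a')) * (walkPartition K 0 b n x * walkPartition K c b' n y) := by
            ring
        _ ≤ (K (x ⊓ y - a ⊓ a') * K (x ⊔ y - a ⊔ a')) *
            (walkPartition K c b n (x ⊓ y) * walkPartition K 0 b' n (x ⊔ y)) :=
          mul_le_mul' (hTP x y a a') (ih x y)
        _ = _ := by ring

/-- Integrating the partition function over the endpoint gives iterates of the step operator. -/
lemma lintegral_walkPartition {K : ℝ → ℝ≥0∞} (hK : Measurable K) (c : ℝ) {W : Set ℝ}
    (hW : MeasurableSet W) (hW0 : W ⊆ Set.Ici 0) (n : ℕ) (a : ℝ) :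
    ∫⁻ b in W, walkPartition K c b n a = (stepOp K c)^[n + 1] (W.indicator 1) a := by
  induction n generalizing a with
  | zero =>
    simp only [walkPartition, zero_add, Function.iterate_one, stepOp]
    rw [lintegral_const_mul' _ _ ENNReal.ofReal_ne_top, ← lintegral_indicator hW,
      ← lintegral_indicator measurableSet_Ici]
    congr 1
    refine lintegral_congr fun b => ?_
    by_cases hb : b ∈ W
    · simp [hb, Set.indicator_of_mem (hW0 hb)]
    · simp [hb, Set.indicator_apply]
  | succ n ih =>
    rw [Function.iterate_succ_apply']
    simp only [walkPartition]
    simp only [stepOp]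
    rw [lintegral_const_mul' _ _ ENNReal.ofReal_ne_top, lintegral_lintegral_swap]
    · congr 1
      refine lintegral_congr fun x => ?_
      rw [lintegral_const_mul _ (measurable_walkPartition_right hK c x n), ih]
    · refine Measurable.aemeasurable (Measurable.mul (hK.comp (measurable_snd.sub_const a)) ?_)
      exact (measurable_walkPartition hK c n).comp (measurable_snd.prodMk measurable_fst)

lemma lintegral_walkPartition_zero_le_one {K : ℝ → ℝ≥0∞} (hK : Measurable K)
    (hK1 : ∫⁻ x, K x = 1) (n : ℕ) (a : ℝ) : ∫⁻ b, walkPartition K 0 b n a ≤ 1 := by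
  induction n generalizing a with
  | zero =>
    simp only [walkPartition, zero_mul, neg_zero, Real.exp_zero, ENNReal.ofReal_one, one_mul]
    rw [lintegral_sub_right_eq_self K a, hK1]
  | succ n ih =>
    simp only [walkPartition, stepOp, zero_mul, neg_zero, Real.exp_zero, ENNReal.ofReal_one,
      one_mul]
    rw [lintegral_lintegral_swap]
    · calc _ ≤ ∫⁻ x in Set.Ici 0, K (x - a) := by
            refine lintegral_mono fun x => ?_
            rw [lintegral_const_mul _ (measurable_walkPartition_right hK 0 x n)]
            exact mul_le_of_le_one_right' (ih x)
        _ ≤ ∫⁻ x, K (x - a) := setLIntegral_le_lintegral _ _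
        _ = 1 := by rw [lintegral_sub_right_eq_self K a, hK1]
    · refine Measurable.aemeasurable (Measurable.mul (hK.comp (measurable_snd.sub_const a)) ?_)
      exact (measurable_walkPartition hK 0 n).comp (measurable_snd.prodMk measurable_fst)

lemma walkPartition_pos {K : ℝ → ℝ≥0∞} (hK : Measurable K) (hpos : ∀ x, 0 < K x) (c b : ℝ) (n : ℕ)
    (a : ℝ) : 0 < walkPartition K c b n a := by
  induction n generalizing a with
  | zero =>
    exact ENNReal.mul_pos (ENNReal.ofReal_pos.2 (Real.exp_pos _)).ne' (hpos _).ne'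
  | succ n ih =>
    refine ENNReal.mul_pos (ENNReal.ofReal_pos.2 (Real.exp_pos _)).ne' ?_
    have hm : Measurable fun x => K (x - a) * walkPartition K c b n x :=
      (hK.comp (measurable_id.sub_const a)).mul (measurable_walkPartition_left hK c b n)
    rw [← pos_iff_ne_zero, setLIntegral_pos_iff hm]
    have : Function.support (fun x => K (x - a) * walkPartition K c b n x) = Set.univ := by
      ext x
      simpa using ⟨(hpos _).ne', (ih x).ne'⟩
    simp [this]

lemma walkPartition_zero_ne_top {K : ℝ → ℝ≥0∞} {M : ℝ≥0∞} (hM : M ≠ ∞)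
    (hKM : ∀ x, K x ≤ M) (hK1 : ∫⁻ x, K x = 1) (b : ℝ) (n : ℕ) (a : ℝ) :
    walkPartition K 0 b n a ≠ ∞ := by
  suffices walkPartition K 0 b n a ≤ M from ne_top_of_le_ne_top hM this
  induction n generalizing a with
  | zero => simpa [walkPartition] using hKM _
  | succ n ih =>
    simp only [walkPartition, stepOp, zero_mul, neg_zero, Real.exp_zero, ENNReal.ofReal_one,
      one_mul]
    calc _ ≤ ∫⁻ x in Set.Ici 0, K (x - a) * M :=
          lintegral_mono fun x => mul_le_mul' le_rfl (ih x)
      _ ≤ ∫⁻ x, K (x - a) * M := setLIntegral_le_lintegral _ _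
      _ = M := by
        rw [lintegral_mul_const' _ _ hM, lintegral_sub_right_eq_self K a, hK1, one_mul]

/-- Raising the endpoints lowers the tilted-to-untilted ratio, so the ratio is bounded below by the
mass of tilted walks from a higher starting point to any set of higher endpoints. -/
lemma iterate_stepOp_le_walkPartition_div {K : ℝ → ℝ≥0∞} (hK : Measurable K)
    (hTP : IsTotallyPositive K) (hpos : ∀ x, 0 < K x) {M : ℝ≥0∞} (hM : M ≠ ∞)
    (hKM : ∀ x, K x ≤ M) (hK1 : ∫⁻ x, K x = 1) {c : ℝ} (hc : 0 ≤ c) {a a' b b' : ℝ}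
    (ha : a ≤ a') (hb : b ≤ b') (hb0 : 0 ≤ b') (n : ℕ) :
    (stepOp K c)^[n + 1] ((Set.Ici b').indicator 1) a'
      ≤ walkPartition K c b n a / walkPartition K 0 b n a := by
  rw [ENNReal.le_div_iff_mul_le (Or.inl (walkPartition_pos hK hpos _ _ _ _).ne')
    (Or.inl (walkPartition_zero_ne_top hM hKM hK1 _ _ _)),
    ← lintegral_walkPartition hK c measurableSet_Ici (Set.Ici_subset_Ici.2 hb0), mul_comm,
    ← lintegral_const_mul _ (measurable_walkPartition_right hK c a' n)]
  calc _ ≤ ∫⁻ d in Set.Ici b', walkPartition K c b n a * walkPartition K 0 d n a' := by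
        refine setLIntegral_mono
          ((measurable_walkPartition_right hK 0 a' n).const_mul _) fun d hd => ?_
        have := walkPartition_mul_le_inf_sup hK hTP hc (hb.trans hd) n a a'
        rwa [inf_eq_left.2 ha, sup_eq_right.2 ha] at this
    _ = walkPartition K c b n a * ∫⁻ d in Set.Ici b', walkPartition K 0 d n a' :=
        lintegral_const_mul _ (measurable_walkPartition_right hK 0 a' n)
    _ ≤ walkPartition K c b n a * 1 := by
        gcongr
        exact (setLIntegral_le_lintegral _ _).trans
          (lintegral_walkPartition_zero_le_one hK hK1 n a')
    _ = _ := mul_one _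

end Monotonicity

section Tube

/-- One step of a random walk killed outside `S`. -/
noncomputable def tubeOp (K : ℝ → ℝ≥0∞) (S : Set ℝ) (φ : ℝ → ℝ≥0∞) (x : ℝ) : ℝ≥0∞ :=
  ∫⁻ y in S, K (y - x) * φ y

/-- A centered probability density with variance `v`, third moment `m₃` and fourth moment `m₄`. -/
structure StepMoments (p : ℝ → ℝ) (v m₃ m₄ : ℝ) : Prop where
  nonneg : ∀ x, 0 ≤ p x
  integrable_pow : ∀ i : ℕ, Integrable fun x => x ^ i * p x
  mass : ∫ x, p x = 1
  mean : ∫ x, x * p x = 0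
  second : ∫ x, x ^ 2 * p x = v
  third : ∫ x, x ^ 3 * p x = m₃
  fourth : ∫ x, x ^ 4 * p x = m₄

lemma ofReal_integral_le_lintegral_ofReal {f : ℝ → ℝ} (hf : Integrable f) :
    ENNReal.ofReal (∫ x, f x) ≤ ∫⁻ x, ENNReal.ofReal (f x) := by
  calc ENNReal.ofReal (∫ x, f x) ≤ ENNReal.ofReal (∫ x, max (f x) 0) :=
        ENNReal.ofReal_le_ofReal (integral_mono hf hf.pos_part fun x => le_max_left _ _)
    _ = ∫⁻ x, ENNReal.ofReal (max (f x) 0) :=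
        ofReal_integral_eq_lintegral_ofReal hf.pos_part (ae_of_all _ fun x => le_max_right _ _)
    _ = ∫⁻ x, ENNReal.ofReal (f x) := by simp

/-- Subsolutions of the one-step equation that are nonpositive outside the tube bound the killed
walk from below. -/
lemma ofReal_le_tubeOp_iterate {p : ℝ → ℝ} (hp : ∀ x, 0 ≤ p x) {S : Set ℝ} (hS : MeasurableSet S)
    {G : ℕ → ℝ → ℝ} (hfin : ∀ k x, Integrable fun y => p (y - x) * G k y)
    (hstep : ∀ k x, G (k + 1) x ≤ ∫ y, p (y - x) * G k y) (hneg : ∀ k, ∀ y ∉ S, G k y ≤ 0)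
    {φ : ℝ → ℝ≥0∞} (h0 : ∀ x, ENNReal.ofReal (G 0 x) ≤ φ x) (k : ℕ) (x : ℝ) :
    ENNReal.ofReal (G k x) ≤ (tubeOp (fun z => ENNReal.ofReal (p z)) S)^[k] φ x := by
  induction k generalizing x with
  | zero => exact h0 x
  | succ k ih =>
    rw [Function.iterate_succ_apply']
    calc ENNReal.ofReal (G (k + 1) x) ≤ ENNReal.ofReal (∫ y, p (y - x) * G k y) :=
          ENNReal.ofReal_le_ofReal (hstep k x)
      _ ≤ ∫⁻ y, ENNReal.ofReal (p (y - x) * G k y) := ofReal_integral_le_lintegral_ofReal (hfin k x)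
      _ ≤ _ := by
        rw [tubeOp, ← lintegral_indicator hS]
        refine lintegral_mono fun y => ?_
        by_cases hy : y ∈ S
        · rw [Set.indicator_of_mem hy, ENNReal.ofReal_mul (hp _)]
          exact mul_le_mul' le_rfl (ih y)
        · rw [Set.indicator_of_notMem hy, ENNReal.ofReal_of_nonpos]
          exact mul_nonpos_of_nonneg_of_nonpos (hp _) (hneg k y hy)

namespace StepMoments

variable {p : ℝ → ℝ} {v m₃ m₄ : ℝ}

lemma integral_quartic (hp : StepMoments p v m₃ m₄) (c₀ c₁ c₂ c₃ c₄ x : ℝ) :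
    Integrable (fun y => p (y - x) * (c₀ + c₁ * (y - x) + c₂ * (y - x) ^ 2 + c₃ * (y - x) ^ 3
      + c₄ * (y - x) ^ 4)) ∧
    ∫ y, p (y - x) * (c₀ + c₁ * (y - x) + c₂ * (y - x) ^ 2 + c₃ * (y - x) ^ 3
      + c₄ * (y - x) ^ 4) = c₀ + c₂ * v + c₃ * m₃ + c₄ * m₄ := by
  have i0 : Integrable fun z => c₀ * p z := by
    simpa using (hp.integrable_pow 0).const_mul c₀
  have i1 : Integrable fun z => c₁ * (z * p z) := by
    simpa using (hp.integrable_pow 1).const_mul c₁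
  have i2 := (hp.integrable_pow 2).const_mul c₂
  have i3 := (hp.integrable_pow 3).const_mul c₃
  have i4 := (hp.integrable_pow 4).const_mul c₄
  have j1 : Integrable fun z => c₀ * p z + c₁ * (z * p z) := i0.add i1
  have j2 : Integrable fun z => c₀ * p z + c₁ * (z * p z) + c₂ * (z ^ 2 * p z) := j1.add i2
  have j3 : Integrable fun z => c₀ * p z + c₁ * (z * p z) + c₂ * (z ^ 2 * p z)
      + c₃ * (z ^ 3 * p z) := j2.add i3
  have e : (fun z => p z * (c₀ + c₁ * z + c₂ * z ^ 2 + c₃ * z ^ 3 + c₄ * z ^ 4))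
      = fun z => c₀ * p z + c₁ * (z * p z) + c₂ * (z ^ 2 * p z) + c₃ * (z ^ 3 * p z)
        + c₄ * (z ^ 4 * p z) := by
    funext z; ring
  have hfin : Integrable fun z => p z * (c₀ + c₁ * z + c₂ * z ^ 2 + c₃ * z ^ 3 + c₄ * z ^ 4) := by
    rw [e]; exact j3.add i4
  refine ⟨hfin.comp_sub_right x, ?_⟩
  rw [integral_sub_right_eq_self
    (fun z => p z * (c₀ + c₁ * z + c₂ * z ^ 2 + c₃ * z ^ 3 + c₄ * z ^ 4)) x, e,
    integral_add j3 i4, integral_add j2 i3, integral_add j1 i2, integral_add i0 i1]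
  simp only [integral_const_mul, hp.mass, hp.mean, hp.second, hp.third, hp.fourth]
  ring

/-- The polynomial `E[A₀ + A₁ S + A₂ S² + A₄ S⁴]` for a walk `S` started at `w` and run for `k`
steps with variance `v`, third moment `m₃` and fourth moment `m₄`. -/
def heatPoly (v m₃ m₄ A₀ A₁ A₂ A₄ : ℝ) (k : ℕ) (w : ℝ) : ℝ :=
  A₀ + A₁ * w + A₂ * (w ^ 2 + k * v)
    + A₄ * (w ^ 4 + 6 * w ^ 2 * (k * v) + 4 * w * (k * m₃) + k * m₄ + 3 * k * (k - 1) * v ^ 2)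

lemma integral_heatPoly (hp : StepMoments p v m₃ m₄) (A₀ A₁ A₂ A₄ x₀ : ℝ) (k : ℕ) (x : ℝ) :
    Integrable (fun y => p (y - x) * heatPoly v m₃ m₄ A₀ A₁ A₂ A₄ k (y - x₀)) ∧
    ∫ y, p (y - x) * heatPoly v m₃ m₄ A₀ A₁ A₂ A₄ k (y - x₀)
      = heatPoly v m₃ m₄ A₀ A₁ A₂ A₄ (k + 1) (x - x₀) := by
  have := hp.integral_quartic (heatPoly v m₃ m₄ A₀ A₁ A₂ A₄ k (x - x₀))
    (A₁ + 2 * A₂ * (x - x₀) + A₄ * (4 * (x - x₀) ^ 3 + 12 * (x - x₀) * (k * v) + 4 * (k * m₃)))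
    (A₂ + A₄ * (6 * (x - x₀) ^ 2 + 6 * (k * v))) (A₄ * (4 * (x - x₀))) A₄ x
  have e : ∀ y, p (y - x) * heatPoly v m₃ m₄ A₀ A₁ A₂ A₄ k (y - x₀)
      = p (y - x) * (heatPoly v m₃ m₄ A₀ A₁ A₂ A₄ k (x - x₀)
        + (A₁ + 2 * A₂ * (x - x₀)
          + A₄ * (4 * (x - x₀) ^ 3 + 12 * (x - x₀) * (k * v) + 4 * (k * m₃))) * (y - x)
        + (A₂ + A₄ * (6 * (x - x₀) ^ 2 + 6 * (k * v))) * (y - x) ^ 2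
        + (A₄ * (4 * (x - x₀))) * (y - x) ^ 3 + A₄ * (y - x) ^ 4) := by
    intro y
    unfold heatPoly
    ring
  simp only [e]
  refine ⟨this.1, this.2.trans ?_⟩
  unfold heatPoly
  push_cast
  ring

lemma heatPoly_le (hp : StepMoments p v m₃ m₄) {A₀ A₁ A₂ A₄ F : ℝ}
    (h : ∀ w, heatPoly v m₃ m₄ A₀ A₁ A₂ A₄ 0 w ≤ F) (k : ℕ) (w : ℝ) :
    heatPoly v m₃ m₄ A₀ A₁ A₂ A₄ k w ≤ F := by
  induction k generalizing w with
  | zero => exact h w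
  | succ k ih =>
    have h1 := hp.integral_heatPoly A₀ A₁ A₂ A₄ 0 k w
    have h2 := hp.integral_quartic F 0 0 0 0 w
    simp only [sub_zero, zero_mul, add_zero] at h1 h2
    rw [← h1.2, ← h2.2]
    exact integral_mono h1.1 h2.1 fun y => mul_le_mul_of_nonneg_left (ih y) (hp.nonneg _)

lemma fourth_nonneg (hp : StepMoments p v m₃ m₄) : 0 ≤ m₄ := by
  rw [← hp.fourth]
  exact integral_nonneg fun x => mul_nonneg (by positivity) (hp.nonneg x)

/-- The test function used to detect displacements of a definite sign at unit scale. -/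
lemma testFunction_bounds {β v s : ℝ} (hβ : 0 < β) (hβ1 : β ≤ 1) (hv : 0 < v) :
    (s < min 1 (β * v / 8) → s + β * s ^ 2 - β ^ 3 * s ^ 4 - β * v / 4 ≤ 0) ∧
    (2 / β < s → s + β * s ^ 2 - β ^ 3 * s ^ 4 - β * v / 4 ≤ 0) ∧
    s + β * s ^ 2 - β ^ 3 * s ^ 4 - β * v / 4 ≤ 6 / β := by
  have hη : 0 < β * v / 4 := by positivity
  have key : β * (s + β * s ^ 2 - β ^ 3 * s ^ 4) = β * s + (β * s) ^ 2 - (β * s) ^ 4 := by ring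
  have of_nonpos : β * s + (β * s) ^ 2 - (β * s) ^ 4 ≤ 0 →
      s + β * s ^ 2 - β ^ 3 * s ^ 4 - β * v / 4 ≤ 0 := by
    intro h
    rw [← key] at h
    have := nonpos_of_mul_nonpos_right h hβ
    linarith
  refine ⟨fun hs => ?_, fun hs => ?_, ?_⟩
  · rcases le_or_gt s 0 with h0 | h0
    · apply of_nonpos
      have hu : β * s ≤ 0 := mul_nonpos_of_nonneg_of_nonpos hβ.le h0
      generalize β * s = u at hu
      rcases le_total (-1) u with h1 | h1
      · nlinarith [mul_nonneg (neg_nonneg.2 hu) (by linarith : 0 ≤ 1 + u), sq_nonneg (u ^ 2)]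
      · nlinarith [mul_nonneg (sq_nonneg u) (by nlinarith : 0 ≤ u ^ 2 - 1)]
    · have h1 := hs.trans_le (min_le_left _ _)
      have h2 := hs.trans_le (min_le_right _ _)
      have h3 : β * s ^ 2 ≤ s := by nlinarith [mul_pos h0 h0, mul_pos hβ h0]
      have h4 : 0 ≤ β ^ 3 * s ^ 4 := by positivity
      linarith
  · apply of_nonpos
    have hu : 2 < β * s := by rwa [div_lt_iff₀' hβ] at hs
    generalize β * s = u at hu
    nlinarith [mul_nonneg (sq_nonneg u) (by nlinarith : 0 ≤ u ^ 2 - 4)]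
  · rw [le_div_iff₀' hβ, mul_sub, key]
    have : 0 ≤ β * (β * v / 4) := by positivity
    generalize β * s = u
    nlinarith [sq_nonneg (u ^ 2 - 1), sq_nonneg (u - 1)]

/-- Uniformly over diffusive space-time windows, the walk makes a displacement of definite sign
`ε` and diffusive size while remaining in a diffusive tube. -/
lemma le_tubeOp_iterate_of_sign (hp : StepMoments p v m₃ m₄) (hv : 0 < v) {β : ℝ} (hβ : 0 < β)
    (hβ1 : β ≤ 1) (hβm : β ^ 2 * (4 * m₄ + 48 * v ^ 2) ≤ v / 4) {ε : ℝ} (hε : ε ^ 2 = 1)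
    {l : ℝ} (hl : 1 ≤ l) {m : ℕ} (hm1 : l ^ 2 ≤ m) (hm2 : m ≤ 4 * l ^ 2) (x₀ : ℝ) :
    ENNReal.ofReal (β ^ 2 * v / 25) ≤
      (tubeOp (fun z => ENNReal.ofReal (p z))
        (Set.Icc (x₀ - 10 / β * l) (x₀ + 10 / β * l)))^[m]
        ({y | min 1 (β * v / 8) * l ≤ ε * (y - x₀) ∧ ε * (y - x₀) ≤ 2 / β * l}.indicator 1) x₀ := by
  have hl0 : 0 < l := by linarith
  set F : ℝ := 6 / β with hF
  have hF0 : 0 < F := by positivity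
  set P : ℕ → ℝ → ℝ := heatPoly v m₃ m₄ (-(β * v / 4)) (ε / l) (β / l ^ 2) (-(β ^ 3 / l ^ 4))
    with hP
  set G : ℕ → ℝ → ℝ := fun k y => heatPoly v m₃ m₄ (-(β * v / 4) / F) (ε / l / F)
    (β / l ^ 2 / F - 1 / (10 / β * l) ^ 2) (-(β ^ 3 / l ^ 4) / F) k (y - x₀) with hG
  have hGP : ∀ k y, G k y
      = P k (y - x₀) / F - ((y - x₀) ^ 2 + k * v) / (10 / β * l) ^ 2 := by
    intro k y
    simp only [hG, hP, heatPoly]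
    ring
  have hε4 : ε ^ 4 = 1 := by rw [show (4 : ℕ) = 2 * 2 from rfl, pow_mul, hε, one_pow]
  have hP0 : ∀ w, P 0 w = (ε * w / l) + β * (ε * w / l) ^ 2 - β ^ 3 * (ε * w / l) ^ 4
      - β * v / 4 := by
    intro w
    simp only [hP, heatPoly, div_pow, mul_pow, hε, hε4]
    push_cast
    ring
  have hPF : ∀ k w, P k w ≤ F := by
    refine hp.heatPoly_le fun w => ?_
    change P 0 w ≤ F
    rw [hP0]
    exact (testFunction_bounds hβ hβ1 hv).2.2
  have hPF1 : ∀ k w, P k w / F ≤ 1 := fun k w => (div_le_one hF0).2 (hPF k w)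
  have hneg : ∀ k, ∀ y ∉ Set.Icc (x₀ - 10 / β * l) (x₀ + 10 / β * l), G k y ≤ 0 := by
    intro k y hy
    have hL : 0 < 10 / β * l := by positivity
    have hw : (10 / β * l) ^ 2 ≤ (y - x₀) ^ 2 := by
      rw [sq_le_sq, abs_of_pos hL]
      by_contra hcon
      push Not at hcon
      obtain ⟨h1, h2⟩ := abs_lt.1 hcon
      exact hy ⟨by linarith, by linarith⟩
    have hkv : 0 ≤ k * v := by positivity
    have : 1 ≤ ((y - x₀) ^ 2 + k * v) / (10 / β * l) ^ 2 := by
      rw [one_le_div (by positivity)]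
      linarith
    rw [hGP]
    linarith [hPF1 k (y - x₀)]
  have h0 : ∀ x, ENNReal.ofReal (G 0 x) ≤
      {y | min 1 (β * v / 8) * l ≤ ε * (y - x₀) ∧ ε * (y - x₀) ≤ 2 / β * l}.indicator 1 x := by
    intro x
    have hle : G 0 x ≤ P 0 (x - x₀) / F := by
      rw [hGP]
      have : 0 ≤ ((x - x₀) ^ 2 + (0 : ℕ) * v) / (10 / β * l) ^ 2 := by positivity
      linarith
    by_cases hx : x ∈ {y | min 1 (β * v / 8) * l ≤ ε * (y - x₀) ∧ ε * (y - x₀) ≤ 2 / β * l}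
    · rw [Set.indicator_of_mem hx, Pi.one_apply, ENNReal.ofReal_le_one]
      exact hle.trans (hPF1 0 _)
    · rw [Set.indicator_of_notMem hx, nonpos_iff_eq_zero, ENNReal.ofReal_eq_zero]
      refine hle.trans (div_nonpos_of_nonpos_of_nonneg ?_ hF0.le)
      rw [hP0]
      rw [Set.mem_ofPred_eq, not_and_or, not_le, not_le] at hx
      rcases hx with hx | hx
      · exact (testFunction_bounds hβ hβ1 hv).1 (by rwa [div_lt_iff₀ hl0])
      · exact (testFunction_bounds hβ hβ1 hv).2.1 (by rwa [lt_div_iff₀ hl0])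
  have main := ofReal_le_tubeOp_iterate hp.nonneg measurableSet_Icc
    (fun k x => (hp.integral_heatPoly _ _ _ _ x₀ k x).1)
    (fun k x => (hp.integral_heatPoly _ _ _ _ x₀ k x).2.ge) hneg h0 m x₀
  refine le_trans (ENNReal.ofReal_le_ofReal ?_) main
  change _ ≤ G m x₀
  have hm4 := hp.fourth_nonneg
  have hm0 : (0 : ℝ) ≤ m := by positivity
  have hl2 : 1 ≤ l ^ 2 := one_le_pow₀ hl
  have hPm : β * v / 2 ≤ P m (x₀ - x₀) := by
    have e : P m (x₀ - x₀) = β * (m / l ^ 2) * v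
        - β * (β ^ 2 * ((m * m₄ + 3 * m * (m - 1) * v ^ 2) / l ^ 4)) - β * v / 4 := by
      simp only [hP, heatPoly]
      ring
    have h1 : 1 ≤ m / l ^ 2 := by rwa [one_le_div (by positivity)]
    have h2 : (m * m₄ + 3 * m * (m - 1) * v ^ 2) / l ^ 4 ≤ 4 * m₄ + 48 * v ^ 2 := by
      rw [div_le_iff₀ (by positivity)]
      have a1 : (m : ℝ) ≤ 4 * l ^ 4 := by nlinarith
      have a2 : (m : ℝ) * (m - 1) ≤ 16 * l ^ 4 := by nlinarith
      nlinarith [mul_le_mul_of_nonneg_right a1 hm4, mul_le_mul_of_nonneg_right a2 (sq_nonneg v)]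
    have h3 : β * (β ^ 2 * ((m * m₄ + 3 * m * (m - 1) * v ^ 2) / l ^ 4)) ≤ β * (v / 4) :=
      mul_le_mul_of_nonneg_left
        ((mul_le_mul_of_nonneg_left h2 (sq_nonneg β)).trans hβm) hβ.le
    have h4 : β * 1 * v ≤ β * (m / l ^ 2) * v := by gcongr
    rw [e]
    linarith
  have hexit : (m : ℝ) * v / (10 / β * l) ^ 2 ≤ β ^ 2 * v / 25 := by
    rw [div_le_iff₀ (by positivity)]
    have : β ^ 2 * v / 25 * (10 / β * l) ^ 2 = 4 * l ^ 2 * v := by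
      field_simp; ring
    rw [this]
    gcongr
  have hPdiv : β ^ 2 * v / 12 ≤ P m (x₀ - x₀) / F := by
    rw [le_div_iff₀ hF0]
    have : β ^ 2 * v / 12 * F = β * v / 2 := by
      rw [hF]; field_simp; ring
    rwa [this]
  rw [hGP]
  have e0 : (x₀ - x₀) ^ 2 + m * v = m * v := by ring
  rw [e0]
  have : 0 ≤ β ^ 2 * v := by positivity
  linarith

end StepMoments

end Tube

section Paths

lemma mul_tubeOp_iterate_le_stepOp_iterate {K : ℝ → ℝ≥0∞} {c top : ℝ} (hc : 0 ≤ c) {S : Set ℝ}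
    (hS : MeasurableSet S) (hS0 : S ⊆ Set.Icc 0 top) {φ ψ : ℝ → ℝ≥0∞} {τ : ℝ≥0∞} (hτ : τ ≠ ∞)
    (h : ∀ y ∈ S, τ * ψ y ≤ φ y) (m : ℕ) {x : ℝ} (hx : x ∈ S) :
    ENNReal.ofReal (Real.exp (-(c * top))) ^ m * τ * (tubeOp K S)^[m] ψ x
      ≤ (stepOp K c)^[m] φ x := by
  induction m generalizing x with
  | zero => simpa using h x hx
  | succ m ih =>
    rw [Function.iterate_succ_apply', Function.iterate_succ_apply']
    have hq : ENNReal.ofReal (Real.exp (-(c * top))) ^ m * τ ≠ ∞ :=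
      ENNReal.mul_ne_top (ENNReal.pow_ne_top ENNReal.ofReal_ne_top) hτ
    have hexp : ENNReal.ofReal (Real.exp (-(c * top))) ≤ ENNReal.ofReal (Real.exp (-(c * x))) := by
      refine ENNReal.ofReal_le_ofReal (Real.exp_le_exp.2 ?_)
      have := mul_le_mul_of_nonneg_left (hS0 hx).2 hc
      linarith
    calc _ = ENNReal.ofReal (Real.exp (-(c * top))) *
          (ENNReal.ofReal (Real.exp (-(c * top))) ^ m * τ * tubeOp K S ((tubeOp K S)^[m] ψ) x) := by
            ring
      _ ≤ _ := by
        refine mul_le_mul' hexp ?_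
        rw [tubeOp, ← lintegral_const_mul' _ _ hq]
        calc _ ≤ ∫⁻ y in S, K (y - x) * (stepOp K c)^[m] φ y := by
              refine setLIntegral_mono' hS fun y hy => ?_
              rw [mul_left_comm]
              exact mul_le_mul' le_rfl (ih hy)
          _ ≤ _ := lintegral_mono_set fun y hy => (hS0 hy).1

/-- Over a time window `m ≍ l²` the tilted killed walk moves between windows of width of order `l`
whose centers are at distance at most `α l`, at a cost of `κ` plus the tilt. -/
def HasBlockBound (K : ℝ → ℝ≥0∞) (α k Λ κ : ℝ) : Prop :=
  ∀ c : ℝ, 0 ≤ c → ∀ l : ℝ, 1 ≤ l → ∀ m : ℕ, l ^ 2 ≤ m → m ≤ 4 * l ^ 2 →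
    ∀ g g' top : ℝ, |g' - g| ≤ α * l → Λ * l ≤ g → g + Λ * l ≤ top →
    ∀ (φ : ℝ → ℝ≥0∞) (E : ℝ),
      (∀ y ∈ Set.Icc (g' - k * l) (g' + k * l), ENNReal.ofReal (Real.exp (-E)) ≤ φ y) →
      ∀ x ∈ Set.Icc (g - k * l) (g + k * l),
        ENNReal.ofReal (Real.exp (-(E + (κ + c * m * top)))) ≤ (stepOp K c)^[m] φ x

lemma StepMoments.exists_hasBlockBound {p : ℝ → ℝ} {v m₃ m₄ : ℝ} (hp : StepMoments p v m₃ m₄)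
    (hv : 0 < v) : ∃ α k Λ κ : ℝ, 0 < α ∧ 0 < k ∧ k ≤ Λ ∧ 0 ≤ κ ∧
      HasBlockBound (fun z => ENNReal.ofReal (p z)) α k Λ κ := by
  have hm4 := hp.fourth_nonneg
  set q : ℝ := 4 * m₄ + 48 * v ^ 2 with hq
  have hq0 : 0 < q := by positivity
  obtain ⟨β, hβ, hβ1, hβm⟩ : ∃ β : ℝ, 0 < β ∧ β ≤ 1 ∧ β ^ 2 * q ≤ v / 4 := by
    refine ⟨min 1 (v / 4 / q), by positivity, min_le_left _ _, ?_⟩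
    have h1 : min 1 (v / 4 / q) ≤ 1 := min_le_left _ _
    have h2 : min 1 (v / 4 / q) ≤ v / 4 / q := min_le_right _ _
    have h0 : 0 < min 1 (v / 4 / q) := by positivity
    rw [← le_div_iff₀ hq0]
    nlinarith
  set δ : ℝ := min 1 (β ^ 2 * v / 25) with hδ
  have hδ0 : 0 < δ := by positivity
  refine ⟨min 1 (β * v / 8), 2 / β, 2 / β + 10 / β, -Real.log δ, by positivity, by positivity,
    by linarith [show 0 < 10 / β by positivity],
    neg_nonneg.2 (Real.log_nonpos hδ0.le (min_le_left _ _)), ?_⟩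
  intro c hc l hl m hm1 hm2 g g' top hgg hg htop φ E hφ x hx
  obtain ⟨hgg1, hgg2⟩ := abs_le.1 hgg
  obtain ⟨hx1, hx2⟩ := hx
  have hl0 : 0 < l := by linarith
  set α : ℝ := min 1 (β * v / 8)
  have hα0 : 0 < α := by positivity
  obtain ⟨ε, hε, hsub⟩ : ∃ ε : ℝ, ε ^ 2 = 1 ∧
      ∀ y, α * l ≤ ε * (y - x) ∧ ε * (y - x) ≤ 2 / β * l →
        y ∈ Set.Icc (g' - 2 / β * l) (g' + 2 / β * l) := by
    rcases le_total g' x with h | h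
    · exact ⟨-1, by norm_num, fun y ⟨h1, h2⟩ => ⟨by linarith, by linarith⟩⟩
    · exact ⟨1, by norm_num, fun y ⟨h1, h2⟩ => ⟨by linarith, by linarith⟩⟩
  have hblock := hp.le_tubeOp_iterate_of_sign hv hβ hβ1 hβm hε hl hm1 hm2 x
  have hxS : x ∈ Set.Icc (x - 10 / β * l) (x + 10 / β * l) := by
    have : 0 < 10 / β * l := by positivity
    exact ⟨by linarith, by linarith⟩
  have hstep := mul_tubeOp_iterate_le_stepOp_iterate (K := fun z => ENNReal.ofReal (p z))
    (φ := φ) (ψ := {y | α * l ≤ ε * (y - x) ∧ ε * (y - x) ≤ 2 / β * l}.indicator 1) hc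
    measurableSet_Icc (S := Set.Icc (x - 10 / β * l) (x + 10 / β * l)) (top := top)
    (Set.Icc_subset_Icc (by linarith) (by linarith))
    (τ := ENNReal.ofReal (Real.exp (-E))) ENNReal.ofReal_ne_top (fun y _ => by
      by_cases hy : y ∈ {y | α * l ≤ ε * (y - x) ∧ ε * (y - x) ≤ 2 / β * l}
      · simpa [Set.indicator_of_mem hy] using hφ y (hsub y hy)
      · simp [Set.indicator_of_notMem hy]) m hxS
  refine le_trans ?_ ((mul_le_mul' le_rfl hblock).trans hstep)
  rw [← ENNReal.ofReal_pow (by positivity), ← ENNReal.ofReal_mul (by positivity),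
    ← ENNReal.ofReal_mul (by positivity)]
  refine ENNReal.ofReal_le_ofReal ?_
  have e : Real.exp (-(E + (-Real.log δ + c * m * top)))
      = Real.exp (-(c * top)) ^ m * Real.exp (-E) * δ := by
    rw [← Real.exp_nat_mul, ← Real.exp_add]
    conv_rhs => rw [← Real.exp_log hδ0, ← Real.exp_add]
    congr 1
    ring
  rw [e]
  gcongr
  exact min_le_right _ _

namespace HasBlockBound

variable {K : ℝ → ℝ≥0∞} {α k Λ κ : ℝ}

lemma chain (hB : HasBlockBound K α k Λ κ) {c : ℝ} (hc : 0 ≤ c) {l : ℝ} (hl : 1 ≤ l) {m : ℕ}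
    (hm1 : l ^ 2 ≤ m) (hm2 : m ≤ 4 * l ^ 2) {d top : ℝ} (hd : |d| ≤ α * l) {φ : ℝ → ℝ≥0∞} {E : ℝ}
    (j : ℕ) {g : ℝ} (hg : Λ * l ≤ g) (hg' : Λ * l ≤ g + j * d) (ht : g + Λ * l ≤ top)
    (ht' : g + j * d + Λ * l ≤ top)
    (hφ : ∀ y ∈ Set.Icc (g + j * d - k * l) (g + j * d + k * l),
      ENNReal.ofReal (Real.exp (-E)) ≤ φ y) :
    ∀ x ∈ Set.Icc (g - k * l) (g + k * l),
      ENNReal.ofReal (Real.exp (-(E + j * (κ + c * m * top)))) ≤ (stepOp K c)^[j * m] φ x := by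
  induction j generalizing g with
  | zero => simpa using hφ
  | succ j ih =>
    push_cast at *
    have hj : (0 : ℝ) ≤ j := Nat.cast_nonneg j
    have e : g + d + j * d = g + (j + 1) * d := by ring
    have hgd : Λ * l ≤ g + d ∧ g + d + Λ * l ≤ top := by
      rcases le_total 0 d with h | h
      · have := mul_nonneg hj h
        exact ⟨by linarith, by linarith⟩
      · have := mul_nonneg hj (neg_nonneg.2 h)
        exact ⟨by linarith, by linarith⟩
    have := ih hgd.1 (by rwa [e]) hgd.2 (by rwa [e]) (by rwa [e])
    intro x hx
    rw [show (j + 1) * m = m + j * m by ring, Function.iterate_add_apply]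
    have h2 := hB c hc l hl m hm1 hm2 g (g + d) top (by simpa using hd) hg ht _ _ this x hx
    convert h2 using 4
    ring

lemma flat (hB : HasBlockBound K α k Λ κ) (hα : 0 < α) (hκ : 0 ≤ κ) {c : ℝ} (hc : 0 ≤ c) {h : ℝ}
    (hh : 1 ≤ h) {g top : ℝ} (hg : Λ * h ≤ g) (ht : g + Λ * h ≤ top) {φ : ℝ → ℝ≥0∞} {E : ℝ}
    (hφ : ∀ y ∈ Set.Icc (g - k * h) (g + k * h), ENNReal.ofReal (Real.exp (-E)) ≤ φ y) (r : ℕ)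
    (hr : h ^ 2 ≤ r) :
    ∀ x ∈ Set.Icc (g - k * h) (g + k * h),
      ENNReal.ofReal (Real.exp (-(E + (κ * (r / h ^ 2) + c * r * top)))) ≤
        (stepOp K c)^[r] φ x := by
  have hh2 : 1 ≤ h ^ 2 := one_le_pow₀ hh
  have hαh : |g - g| ≤ α * h := by rw [sub_self, abs_zero]; positivity
  induction r using Nat.strong_induction_on with
  | _ r ih =>
    rcases le_or_gt (r : ℝ) (4 * h ^ 2) with h4 | h4
    · intro x hx
      refine le_trans ?_ (hB c hc h hh r hr h4 g g top hαh hg ht φ E hφ x hx)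
      refine ENNReal.ofReal_le_ofReal (Real.exp_le_exp.2 ?_)
      have : 1 ≤ r / h ^ 2 := by rwa [one_le_div (by positivity)]
      linarith [mul_le_mul_of_nonneg_left this hκ]
    · set m := ⌈h ^ 2⌉₊ with hm
      have hm1 : h ^ 2 ≤ m := Nat.le_ceil _
      have hm2 : m < h ^ 2 + 1 := Nat.ceil_lt_add_one (by positivity)
      have hm0 : 0 < m := by
        have : (0 : ℝ) < m := by linarith
        exact_mod_cast this
      have hmr : m ≤ r := by
        have : (m : ℝ) ≤ r := by linarith
        exact_mod_cast this
      obtain ⟨s, rfl⟩ := Nat.exists_eq_add_of_le hmr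
      push_cast at *
      have hs := ih s (by omega) (by linarith)
      intro x hx
      rw [Function.iterate_add_apply]
      refine le_trans ?_ (hB c hc h hh m hm1 (by linarith) g g top hαh hg ht _ _ hs x hx)
      refine ENNReal.ofReal_le_ofReal (Real.exp_le_exp.2 ?_)
      have : 1 ≤ m / h ^ 2 := by rwa [one_le_div (by positivity)]
      have h2 := mul_le_mul_of_nonneg_left this hκ
      have e : κ * ((m + s) / h ^ 2) = κ * (m / h ^ 2) + κ * (s / h ^ 2) := by ring
      rw [e]
      linarith

lemma flat_center (hB : HasBlockBound K α k Λ κ) (hα : 0 < α) (hk : 0 < k) (hkΛ : k ≤ Λ)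
    (hκ : 0 ≤ κ) {c : ℝ} (hc : 0 ≤ c)
    {h : ℝ} (hh : 1 ≤ h) {g top : ℝ} (hg : Λ * h ≤ g) (ht : g + Λ * h ≤ top) {φ : ℝ → ℝ≥0∞} {E : ℝ}
    (hφ : ∀ y ∈ Set.Icc (g - k * h) (g + k * h), ENNReal.ofReal (Real.exp (-E)) ≤ φ y) (r : ℕ)
    (hr : 1 ≤ r) :
    ENNReal.ofReal (Real.exp (-(E + (κ * (1 + r / h ^ 2) + c * r * top)))) ≤
        (stepOp K c)^[r] φ g := by
  rcases le_or_gt (h ^ 2) (r : ℝ) with hrh | hrh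
  · refine le_trans ?_ (hB.flat hα hκ hc hh hg ht hφ r hrh g
      ⟨by nlinarith, by nlinarith⟩)
    refine ENNReal.ofReal_le_ofReal (Real.exp_le_exp.2 ?_)
    linarith
  · have hr1 : (1 : ℝ) ≤ r := by exact_mod_cast hr
    have hl : 1 ≤ √(r : ℝ) := Real.one_le_sqrt.2 hr1
    have hsq : √(r : ℝ) ^ 2 = r := Real.sq_sqrt (by positivity)
    have hlh : √(r : ℝ) ≤ h := by
      rw [← Real.sqrt_sq (show 0 ≤ h by linarith)]
      exact Real.sqrt_le_sqrt hrh.le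
    have h1 : k * √(r : ℝ) ≤ k * h := mul_le_mul_of_nonneg_left hlh hk.le
    have h2 : Λ * √(r : ℝ) ≤ Λ * h := mul_le_mul_of_nonneg_left hlh (hk.le.trans hkΛ)
    have h3 : 0 ≤ k * √(r : ℝ) := by positivity
    refine le_trans ?_ (hB c hc _ hl r hsq.le (by rw [hsq]; linarith) g g top
      (by rw [sub_self, abs_zero]; positivity) (by linarith) (by linarith) φ E
      (fun y hy => hφ y ⟨by linarith [hy.1], by linarith [hy.2]⟩) g ⟨by linarith, by linarith⟩)
    refine ENNReal.ofReal_le_ofReal (Real.exp_le_exp.2 ?_)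
    have : 0 ≤ κ * (r / h ^ 2) := by positivity
    linarith

/-- Lower bound for tilted killed walks from a point above `s² h` to the half-line above `s² h`. -/
lemma exists_const (hB : HasBlockBound K α k Λ κ) (hα : 0 < α) (hk : 0 < k) (hkΛ : k ≤ Λ)
    (hκ : 0 ≤ κ) : ∃ C : ℝ, 0 ≤ C ∧ ∀ h s : ℝ, 1 ≤ s → s ≤ h → ∀ T : ℕ, 1 ≤ T →
      ∃ a : ℝ, s ^ 2 * h ≤ a ∧ ENNReal.ofReal (Real.exp (-(C * (s ^ 3 + T / h ^ 2)))) ≤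
        (stepOp K (h ^ 3)⁻¹)^[T] ((Set.Ici (s ^ 2 * h)).indicator 1) a := by
  set b : ℝ := 1 / α + 1 with hb
  have hb0 : 0 < b := by positivity
  have hΛ : 0 < Λ := hk.trans_le hkΛ
  refine ⟨2 * κ * b + 4 * b * (1 + 4 * Λ) + κ + 3 * Λ + (4 * b + 2), by positivity, ?_⟩
  intro h s hs hsh T hT
  have hh : 1 ≤ h := hs.trans hsh
  have hh0 : 0 < h := by linarith
  have hs0 : 0 < s := by linarith
  have hs3 : 1 ≤ s ^ 3 := one_le_pow₀ hs
  have hc : 0 ≤ (h ^ 3)⁻¹ := by positivity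
  have hT0 : 0 ≤ T / h ^ 2 := by positivity
  have hs2h : 0 < s ^ 2 * h := by positivity
  have hΛh : 0 < Λ * h := by positivity
  have hkΛh : k * h ≤ Λ * h := mul_le_mul_of_nonneg_right hkΛ hh0.le
  have hone : ∀ y, s ^ 2 * h ≤ y →
      ENNReal.ofReal (Real.exp (-0)) ≤ (Set.Ici (s ^ 2 * h)).indicator 1 y := by
    intro y hy
    rw [Set.indicator_of_mem (show y ∈ Set.Ici (s ^ 2 * h) from hy)]
    simp
  rcases le_or_gt (T : ℝ) ((4 * b + 2) * s * h ^ 2) with hTs | hTs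
  · refine ⟨s ^ 2 * h + Λ * h, by linarith, ?_⟩
    refine le_trans ?_ (hB.flat_center hα hk hkΛ hκ hc hh (g := s ^ 2 * h + Λ * h)
      (top := s ^ 2 * h + 2 * Λ * h) (by linarith) (by linarith)
      (fun y hy => hone y (by linarith [hy.1])) T hT)
    refine ENNReal.ofReal_le_ofReal (Real.exp_le_exp.2 ?_)
    have e : (h ^ 3)⁻¹ * T * (s ^ 2 * h + 2 * Λ * h) = T / h ^ 2 * (s ^ 2 + 2 * Λ) := by
      field_simp
    have h1 : T / h ^ 2 ≤ (4 * b + 2) * s := by rwa [div_le_iff₀ (by positivity)]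
    have h2 : T / h ^ 2 * s ^ 2 ≤ (4 * b + 2) * s ^ 3 := by
      calc T / h ^ 2 * s ^ 2 ≤ (4 * b + 2) * s * s ^ 2 := by gcongr
        _ = _ := by ring
    rw [e]
    have h3 : κ ≤ κ * s ^ 3 := le_mul_of_one_le_right hκ hs3
    have h4 : 0 ≤ 2 * κ * b + 4 * b * (1 + 4 * Λ) + 3 * Λ := by positivity
    have h5 := mul_nonneg h4 (by positivity : 0 ≤ s ^ 3)
    have h6 : 0 ≤ 2 * κ * b + 4 * b * (1 + 4 * Λ) + Λ + (4 * b + 2) := by positivity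
    have h7 := mul_nonneg h6 hT0
    nlinarith
  · set l : ℝ := h / s with hl
    have hl1 : 1 ≤ l := by rwa [hl, one_le_div hs0]
    have hlh : l ≤ h := div_le_self hh0.le hs
    have hls : l * s = h := div_mul_cancel₀ _ hs0.ne'
    have hΛl : Λ * l ≤ Λ * h := mul_le_mul_of_nonneg_left hlh hΛ.le
    have hkl : k * l ≤ k * h := mul_le_mul_of_nonneg_left hlh hk.le
    have hkl0 : 0 < k * l := by positivity
    set m := ⌈l ^ 2⌉₊ with hm
    have hl2 : 1 ≤ l ^ 2 := one_le_pow₀ hl1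
    have hm1 : l ^ 2 ≤ m := Nat.le_ceil _
    have hm2 : m < l ^ 2 + 1 := Nat.ceil_lt_add_one (by positivity)
    set J := ⌈s ^ 3 / α⌉₊ with hJ
    have hJ1 : s ^ 3 / α ≤ J := Nat.le_ceil _
    have hJ0 : (0 : ℝ) < J := lt_of_lt_of_le (by positivity) hJ1
    have hJ2 : J ≤ b * s ^ 3 := by
      have : J < s ^ 3 / α + 1 := Nat.ceil_lt_add_one (by positivity)
      have e : b * s ^ 3 = s ^ 3 / α + s ^ 3 := by rw [hb]; ring
      linarith
    have hJm : J * m ≤ 2 * b * s * h ^ 2 := by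
      calc (J : ℝ) * m ≤ (b * s ^ 3) * (2 * l ^ 2) := by gcongr; linarith
        _ = 2 * b * s * (l * s) ^ 2 := by ring
        _ = _ := by rw [hls]
    set d : ℝ := s ^ 2 * h / J with hd
    have hJd : J * d = s ^ 2 * h := mul_div_cancel₀ _ hJ0.ne'
    have hd0 : 0 < d := by positivity
    have hdα : d ≤ α * l := by
      rw [hd, div_le_iff₀ hJ0]
      rw [div_le_iff₀ hα] at hJ1
      calc s ^ 2 * h = s ^ 3 * l := by rw [← hls]; ring
        _ ≤ J * α * l := by gcongr
        _ = _ := by ring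
    have hsh2 : h ^ 2 ≤ s * h ^ 2 := le_mul_of_one_le_left (by positivity) hs
    have hTJ : J * m + J * m ≤ T := by
      have : (J : ℝ) * m + J * m ≤ T := by nlinarith
      exact_mod_cast this
    obtain ⟨r, hr⟩ := Nat.exists_eq_add_of_le hTJ
    have hrT : (T : ℝ) = J * m + J * m + r := by rw [hr]; push_cast; ring
    have hrh : h ^ 2 ≤ r := by nlinarith
    set top : ℝ := s ^ 2 * h + 4 * Λ * h with htop
    have hascent : ∀ y ∈ Set.Icc (2 * Λ * h - k * h) (2 * Λ * h + k * h), _ := fun y hy =>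
      hB.chain hc hl1 hm1 (by linarith) (d := d) (top := top) (by rwa [abs_of_pos hd0]) (E := 0)
      (φ := (Set.Ici (s ^ 2 * h)).indicator 1) J (g := y) (by linarith [hy.1])
      (by linarith [hy.1]) (by linarith [hy.2]) (by linarith [hy.2])
      (fun z hz => hone z (by linarith [hz.1, hy.1])) y ⟨by linarith, by linarith⟩
    have hflat := hB.flat hα hκ hc hh (g := 2 * Λ * h) (top := 3 * Λ * h) (by linarith)
      (by linarith) hascent r hrh
    have hdescent := hB.chain hc hl1 hm1 (by linarith) (d := -d) (top := top)
      (by rwa [abs_neg, abs_of_pos hd0]) J (g := s ^ 2 * h + 2 * Λ * h) (by linarith)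
      (by linarith) (by linarith) (by linarith)
      (fun z hz => hflat z ⟨by linarith [hz.1], by linarith [hz.2]⟩) (s ^ 2 * h + 2 * Λ * h)
      ⟨by linarith, by linarith⟩
    refine ⟨s ^ 2 * h + 2 * Λ * h, by linarith, ?_⟩
    rw [show T = J * m + (r + J * m) by omega, Function.iterate_add_apply,
      Function.iterate_add_apply, show J * m + (r + J * m) = T by omega]
    refine le_trans (ENNReal.ofReal_le_ofReal (Real.exp_le_exp.2 ?_)) hdescent
    have e1 : (h ^ 3)⁻¹ * m * top * J = (J * m) * ((s ^ 2 + 4 * Λ) / h ^ 2) := by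
      rw [htop]; field_simp
    have e2 : (h ^ 3)⁻¹ * r * (3 * Λ * h) = 3 * Λ * (r / h ^ 2) := by field_simp
    have h1 : (h ^ 3)⁻¹ * m * top * J ≤ 2 * b * (1 + 4 * Λ) * s ^ 3 := by
      rw [e1]
      calc _ ≤ 2 * b * s * h ^ 2 * ((s ^ 2 + 4 * Λ) / h ^ 2) := by gcongr
        _ = 2 * b * s * (s ^ 2 + 4 * Λ) := by field_simp
        _ ≤ 2 * b * s * (s ^ 2 + 4 * Λ * s ^ 2) := by
          have : 4 * Λ ≤ 4 * Λ * s ^ 2 :=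
            le_mul_of_one_le_right (by positivity) (one_le_pow₀ hs)
          exact mul_le_mul_of_nonneg_left (by linarith) (by positivity)
        _ = _ := by ring
    have h2 : (r : ℝ) / h ^ 2 ≤ T / h ^ 2 := by
      gcongr
      omega
    have h3 : κ * (r / h ^ 2) ≤ κ * (T / h ^ 2) := mul_le_mul_of_nonneg_left h2 hκ
    have h4 : 3 * Λ * (r / h ^ 2) ≤ 3 * Λ * (T / h ^ 2) :=
      mul_le_mul_of_nonneg_left h2 (by positivity)
    have h5 : J * κ ≤ b * s ^ 3 * κ := mul_le_mul_of_nonneg_right hJ2 hκ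
    have h6 : 0 ≤ 2 * κ * b + 4 * b * (1 + 4 * Λ) + (4 * b + 2) := by positivity
    have h7 := mul_nonneg h6 hT0
    have h8 : 0 ≤ (κ + 3 * Λ + (4 * b + 2)) * s ^ 3 := by positivity
    rw [e2]
    linarith

end HasBlockBound

end Paths

section Hamiltonian

namespace RWAssumptions

variable {H : ℝ → ℝ}

lemma continuous (hH : RWAssumptions H) : Continuous H :=
  continuousOn_univ.1 (hH.convex.continuousOn isOpen_univ)

lemma exists_lower_bound (hH : RWAssumptions H) : ∃ m, ∀ x, m ≤ H x := by
  set M := ∫ x, Real.exp (-(H x)) with hM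
  set R := M / Real.exp (-(H 0)) with hR
  have hloc : ∀ x, H x < H 0 → |x| ≤ R := by
    intro x hx
    have hle : ∀ y ∈ Set.uIcc 0 x, H y ≤ H 0 := fun y hy => by
      have := hH.convex.le_max_of_mem_segment (Set.mem_univ 0) (Set.mem_univ x)
        (by rwa [segment_eq_uIcc])
      rwa [max_eq_left hx.le] at this
    rw [hR, le_div_iff₀ (Real.exp_pos _)]
    calc |x| * Real.exp (-(H 0)) = ∫ _ in Set.uIcc 0 x, Real.exp (-(H 0)) := by
          simp [Measure.real, Real.volume_interval]
      _ ≤ ∫ y in Set.uIcc 0 x, Real.exp (-(H y)) := by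
          refine setIntegral_mono_on ?_ hH.integrable_exp.integrableOn measurableSet_uIcc
            fun y hy => Real.exp_le_exp.2 (neg_le_neg (hle y hy))
          exact integrableOn_const (by simp [Real.volume_interval])
      _ ≤ M := setIntegral_le_integral hH.integrable_exp
          (ae_of_all _ fun y => (Real.exp_pos _).le)
  obtain ⟨m, hm⟩ := (isCompact_Icc.image hH.continuous (X := ℝ)).bddBelow (s := H '' Set.Icc (-R) R)
  refine ⟨min m (H 0), fun x => ?_⟩
  rcases lt_or_ge (H x) (H 0) with hx | hx
  · exact (min_le_left _ _).trans (hm ⟨x, abs_le.1 (hloc x hx), rfl⟩)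
  · exact (min_le_right _ _).trans hx

lemma integrable_pow (hH : RWAssumptions H) (i : ℕ) :
    Integrable fun x => x ^ i * Real.exp (-(H x)) := by
  obtain ⟨t, ht, hfin⟩ := hH.mgf
  have hdom := ((hfin t (abs_of_pos ht).le).add
    (hfin (-t) (by rw [abs_neg, abs_of_pos ht]))).const_mul ((i.factorial : ℝ) / t ^ i)
  refine hdom.mono' ?_ (ae_of_all _ fun x => ?_)
  · exact ((continuous_pow i).mul
      (Real.continuous_exp.comp hH.continuous.neg)).aestronglyMeasurable
  · rw [norm_mul, norm_pow, Real.norm_eq_abs, Real.norm_of_nonneg (Real.exp_pos _).le]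
    have h1 := Real.pow_div_factorial_le_exp (t * |x|) (by positivity) i
    have h2 : Real.exp (t * |x|) ≤ Real.exp (t * x) + Real.exp (-t * x) := by
      rcases abs_cases x with ⟨h, _⟩ | ⟨h, _⟩
      · rw [h]; linarith [Real.exp_pos (-t * x)]
      · rw [h, mul_neg, ← neg_mul]; linarith [Real.exp_pos (t * x)]
    have h3 : |x| ^ i ≤ i.factorial / t ^ i * (Real.exp (t * x) + Real.exp (-t * x)) := by
      rw [mul_pow, div_le_iff₀ (by positivity)] at h1
      rw [div_mul_eq_mul_div, le_div_iff₀ (by positivity), mul_comm (|x| ^ i)]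
      refine h1.trans ?_
      rw [mul_comm]
      gcongr
    refine (mul_le_mul_of_nonneg_right h3 (Real.exp_pos _).le).trans_eq ?_
    simp only [Pi.add_apply]
    ring

lemma stepMoments (hH : RWAssumptions H) : ∃ v m₃ m₄, 0 < v ∧
    StepMoments (fun x => Real.exp (-(H x)) / ∫ y, Real.exp (-(H y))) v m₃ m₄ := by
  have hM := hH.norm_pos
  refine ⟨_, _, _, ?_, ⟨fun x => by positivity, fun i => ?_, ?_, ?_, rfl, rfl, rfl⟩⟩
  · simp only [← mul_div_assoc, integral_div]
    exact div_pos hH.var_pos hM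
  · simpa only [mul_div_assoc] using (hH.integrable_pow i).div_const (∫ y, Real.exp (-(H y)))
  · rw [integral_div, div_self hM.ne']
  · simp only [← mul_div_assoc, integral_div, hH.mean_zero, zero_div]

end RWAssumptions

lemma walkPartition_const_mul {r : ℝ≥0∞} (hr : r ≠ ∞) (K : ℝ → ℝ≥0∞) (c b : ℝ) (n : ℕ) (a : ℝ) :
    walkPartition (fun x => r * K x) c b n a = r ^ (n + 1) * walkPartition K c b n a := by
  induction n generalizing a with
  | zero => simp only [walkPartition, zero_add, pow_one]; ring
  | succ n ih =>
    simp only [walkPartition, stepOp, ih]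
    rw [mul_left_comm (r ^ (n + 1 + 1)),
      ← lintegral_const_mul' (r ^ (n + 1 + 1)) _ (by finiteness)]
    congr 1
    refine lintegral_congr fun x => ?_
    ring

lemma walkPartition_div_const_mul {r : ℝ≥0∞} (hr0 : r ≠ 0) (hr : r ≠ ∞) (K : ℝ → ℝ≥0∞)
    (c c' b : ℝ) (n : ℕ) (a : ℝ) :
    walkPartition (fun x => r * K x) c b n a / walkPartition (fun x => r * K x) c' b n a
      = walkPartition K c b n a / walkPartition K c' b n a := by
  rw [walkPartition_const_mul hr, walkPartition_const_mul hr,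
    ENNReal.mul_div_mul_left _ _ (pow_ne_zero _ hr0) (by finiteness)]

lemma Hlam_nonneg {lam N : ℝ} (hl : 0 ≤ lam) (hN : 0 ≤ N) : 0 ≤ Hlam lam N :=
  mul_nonneg (Real.rpow_nonneg hl _) (Real.rpow_nonneg hN _)

lemma Hlam_pow_three {lam N : ℝ} (hl : 0 < lam) (hN : 0 ≤ N) : Hlam lam N ^ 3 = N / lam := by
  rw [Hlam, mul_pow, ← Real.rpow_natCast, ← Real.rpow_natCast, ← Real.rpow_mul hl.le,
    ← Real.rpow_mul hN]
  norm_num [Real.rpow_neg_one]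
  ring

lemma one_le_Hlam {lam N : ℝ} (hl : 0 < lam) (hN : lam ≤ N) : 1 ≤ Hlam lam N := by
  have h0 : 0 ≤ N := hl.le.trans hN
  refine (one_le_pow_iff_of_nonneg (Hlam_nonneg hl.le h0) three_ne_zero).1 ?_
  rwa [Hlam_pow_three hl h0, one_le_div hl]

lemma sqrt_max_pow_three_le {A B : ℝ} (hA : 0 ≤ A) (hB : 0 ≤ B) :
    √(max (max A B) 1) ^ 3 ≤ A ^ ((3 : ℝ) / 2) + B ^ ((3 : ℝ) / 2) + 1 := by
  have h : ∀ x : ℝ, 0 ≤ x → √x ^ 3 = x ^ ((3 : ℝ) / 2) := fun x hx => by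
    rw [Real.sqrt_eq_rpow, ← Real.rpow_natCast, ← Real.rpow_mul hx]
    norm_num
  have hA' : 0 ≤ A ^ ((3 : ℝ) / 2) := Real.rpow_nonneg hA _
  have hB' : 0 ≤ B ^ ((3 : ℝ) / 2) := Real.rpow_nonneg hB _
  rcases max_choice (max A B) 1 with h1 | h1
  · rw [h1]
    rcases max_choice A B with h2 | h2
    · rw [h2, h A hA]; linarith
    · rw [h2, h B hB]; linarith
  · rw [h1]; norm_num; linarith

end Hamiltonian

/-- Partition function lower bound for an area-tilted walk: there exist `c* > 0`
and `N₀` such that for all `N ≥ N₀`, `λ ∈ (0,N)`, all `A, B > 0` with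
`max(A,B) ≤ H_λ²` and any interval (of `n+1` steps) with length at least
`2 max(√A,√B) H_λ²`, the partition function
`Z = E^{AH_λ, BH_λ}_{I;0}[exp(-(λ/N)·𝒜(X))]` (expectation over bridges from
`AH_λ` to `BH_λ` staying above 0) is at least
`(c*)⁻¹ exp(-c*(A^{3/2} + B^{3/2} + |I|/H_λ²))`. -/
theorem partition_function_lower_bound (H : ℝ → ℝ) (hH : RWAssumptions H) :
    ∃ cstar > 0, ∃ N₀ : ℕ, ∀ N : ℕ, N₀ ≤ N → ∀ lam : ℝ, 0 < lam → lam < N →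
      ∀ A B : ℝ, 0 < A → 0 < B → max A B ≤ (Hlam lam N) ^ 2 →
      ∀ n : ℕ, 2 * max (Real.sqrt A) (Real.sqrt B) * (Hlam lam N) ^ 2 ≤ (n : ℝ) + 1 →
        ENNReal.ofReal (cstar⁻¹ *
            Real.exp (-(cstar * (A ^ ((3 : ℝ) / 2) + B ^ ((3 : ℝ) / 2)
              + ((n : ℝ) + 1) / (Hlam lam N) ^ 2))))
          ≤ tiltedMeasure H (A * Hlam lam N) (B * Hlam lam N) n (lam / N)
                (fun _ => 0) Set.univ
              / tiltedMeasure H (A * Hlam lam N) (B * Hlam lam N) n 0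
                (fun _ => 0) Set.univ := by
  set M := ∫ x, Real.exp (-(H x)) with hM
  have hM0 : 0 < M := hH.norm_pos
  set p : ℝ → ℝ := fun x => Real.exp (-(H x)) / M with hp
  set K : ℝ → ℝ≥0∞ := fun x => ENNReal.ofReal (p x) with hK
  obtain ⟨v, m₃, m₄, hv, hmom⟩ := hH.stepMoments
  obtain ⟨α, k, Λ, κ, hα, hk, hkΛ, hκ, hblock⟩ := hmom.exists_hasBlockBound hv
  obtain ⟨C, hC, hbound⟩ := hblock.exists_const hα hk hkΛ hκ
  have hKmeas : Measurable K := by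
    refine ENNReal.measurable_ofReal.comp (Measurable.div_const ?_ _)
    exact Real.measurable_exp.comp hH.continuous.measurable.neg
  have hKpos : ∀ x, 0 < K x := fun x => ENNReal.ofReal_pos.2 (div_pos (Real.exp_pos _) hM0)
  have hK1 : ∫⁻ x, K x = 1 := by
    rw [← ofReal_integral_eq_lintegral_ofReal (by simpa using hmom.integrable_pow 0)
      (ae_of_all _ hmom.nonneg), hmom.mass, ENNReal.ofReal_one]
  have hTP : IsTotallyPositive K := by
    have hconv : ConvexOn ℝ Set.univ fun x => H x + Real.log M :=
      hH.convex.add (convexOn_const _ convex_univ)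
    convert isTotallyPositive_of_convexOn hconv using 2 with x
    rw [neg_add, Real.exp_add, Real.exp_neg (Real.log M), Real.exp_log hM0]
    rfl
  obtain ⟨m, hm⟩ := hH.exists_lower_bound
  have hKM : ∀ x, K x ≤ ENNReal.ofReal (Real.exp (-m) / M) := fun x =>
    ENNReal.ofReal_le_ofReal
      (div_le_div_of_nonneg_right (Real.exp_le_exp.2 (neg_le_neg (hm x))) hM0.le)
  have hscale : (fun x => ENNReal.ofReal (Real.exp (-(H x))))
      = fun x => ENNReal.ofReal M * K x := by
    funext x
    rw [hK, ← ENNReal.ofReal_mul hM0.le, hp]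
    simp only [mul_div_cancel₀ _ hM0.ne']
  refine ⟨Real.exp C, Real.exp_pos C, 0, fun N _ lam hlam hlamN A B hA hB hAB n _ => ?_⟩
  set h := Hlam lam N with hh
  have hN0 : (0 : ℝ) ≤ N := hlam.le.trans hlamN.le
  have h1 : 1 ≤ h := one_le_Hlam hlam hlamN.le
  have hc : lam / N = (h ^ 3)⁻¹ := by rw [hh, Hlam_pow_three hlam hN0, inv_div]
  set s := √(max (max A B) 1) with hs
  have hs2 : s ^ 2 = max (max A B) 1 := Real.sq_sqrt (zero_le_one.trans (le_max_right _ _))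
  have hs1 : 1 ≤ s := Real.one_le_sqrt.2 (le_max_right _ _)
  have hsh : s ≤ h :=
    (Real.sqrt_le_left (by linarith)).2 (max_le hAB (one_le_pow₀ h1))
  have hAs : A * h ≤ s ^ 2 * h := by
    rw [hs2]; gcongr; exact (le_max_left _ _).trans (le_max_left _ _)
  have hBs : B * h ≤ s ^ 2 * h := by
    rw [hs2]; gcongr; exact (le_max_right _ _).trans (le_max_left _ _)
  obtain ⟨a, ha, hlow⟩ := hbound h s hs1 hsh (n + 1) (by omega)
  rw [tiltedMeasure_univ_eq_walkPartition hH.continuous.measurable,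
    tiltedMeasure_univ_eq_walkPartition hH.continuous.measurable, hscale,
    walkPartition_div_const_mul (ENNReal.ofReal_pos.2 hM0).ne' ENNReal.ofReal_ne_top, hc]
  refine le_trans ?_ (hlow.trans (iterate_stepOp_le_walkPartition_div hKmeas hTP hKpos
    ENNReal.ofReal_ne_top hKM hK1 (by positivity) (hAs.trans ha) hBs (by positivity) n))
  rw [← Real.exp_neg, ← Real.exp_add]
  refine ENNReal.ofReal_le_ofReal (Real.exp_le_exp.2 ?_)
  have hs3 := sqrt_max_pow_three_le hA.le hB.le
  have hA' : 0 ≤ A ^ ((3 : ℝ) / 2) := Real.rpow_nonneg hA.le _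
  have hB' : 0 ≤ B ^ ((3 : ℝ) / 2) := Real.rpow_nonneg hB.le _
  have hCexp : C ≤ Real.exp C := by linarith [Real.add_one_le_exp C]
  push_cast
  set S := A ^ ((3 : ℝ) / 2) + B ^ ((3 : ℝ) / 2) + ((n : ℝ) + 1) / h ^ 2 with hS
  have hS0 : 0 ≤ S := by positivity
  have hmono : C * S ≤ Real.exp C * S := mul_le_mul_of_nonneg_right hCexp hS0
  have hCs : C * (s ^ 3 + ((n : ℝ) + 1) / h ^ 2) ≤ C * (S + 1) :=
    mul_le_mul_of_nonneg_left (by linarith) hC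
  linarith
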